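/- Let F : ℝ^{m×d} × ℝ^{m×m} → ℝ be differentiable with 0 ≤ F(W,K) ≤ R for all (W,K), and with blockwise Lipschitz gradients: for every W, K ↦ ∇_K F(W,K) is Lipschitz with constant L_K, and for every K, W ↦ ∇_W F(W,K) is Lipschitz with constant L_W. Let L = max(L_W, L_K) and use diminishing step sizes η_t = 1/(t+1): K^{t+1} = K^t − η_t ∇_K F(W^t, K^t), W^{t+1} = W^t − η_t ∇_W F(W^t, K^{t+1}). Then for every T such that ln(T+2) − L + L/(2(T+1)) > 0: min_{0 ≤ t ≤ T} ( ‖∇_K F(W^t,K^t)‖_F² + ‖∇_W F(W^t,K^{t+1})‖_F² ) ≤ 2R / ( ln(T+2) − L + L/(2(T+1)) ), i.e., the algorithm converges at rate O(1/log T). -/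

import Mathlib

/-- The descent lemma for one gradient step of size `η`. -/
theorem apply_gradient_step_le {E : Type*} [NormedAddCommGroup E] [InnerProductSpace ℝ E]
    [CompleteSpace E] {f : E → ℝ} (hf : Differentiable ℝ f) {L η : ℝ} (hη : 0 ≤ η)
    (hL : ∀ x y, ‖gradient f x - gradient f y‖ ≤ L * ‖x - y‖) (x : E) :
    f (x - η • gradient f x) ≤ f x - (η - L / 2 * η ^ 2) * ‖gradient f x‖ ^ 2 := by
  set g := gradient f x with hg
  have hderiv : ∀ s : ℝ, HasDerivAt
      (fun s : ℝ => f (x - s • g) + (s - L / 2 * s ^ 2) * ‖g‖ ^ 2)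
      (-inner ℝ (gradient f (x - s • g)) g + (1 - L * s) * ‖g‖ ^ 2) s := by
    intro s
    have hpath : HasDerivAt (fun s : ℝ => x - s • g) (-g) s := by
      simpa using ((hasDerivAt_id s).smul_const g).const_sub x
    have hcomp := (hf (x - s • g)).hasGradientAt.hasFDerivAt.comp_hasDerivAt s hpath
    have hpoly : HasDerivAt (fun s : ℝ => (s - L / 2 * s ^ 2) * ‖g‖ ^ 2)
        ((1 - L * s) * ‖g‖ ^ 2) s := by
      have h := ((hasDerivAt_id s).sub ((hasDerivAt_pow 2 s).const_mul (L / 2))).mul_const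
        (‖g‖ ^ 2)
      refine h.congr_deriv ?_
      simp only [Nat.cast_ofNat, Nat.reduceSub, pow_one]
      ring
    refine (hcomp.add hpoly).congr_deriv ?_
    simp
  have hanti : AntitoneOn (fun s : ℝ => f (x - s • g) + (s - L / 2 * s ^ 2) * ‖g‖ ^ 2)
      (Set.Ici 0) := by
    refine antitoneOn_of_deriv_nonpos (convex_Ici 0)
      (fun s _ => (hderiv s).continuousAt.continuousWithinAt)
      (fun s _ => (hderiv s).differentiableAt.differentiableWithinAt) fun s hs => ?_
    rw [interior_Ici, Set.mem_Ioi] at hs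
    rw [(hderiv s).deriv]
    have hlip : ‖g - gradient f (x - s • g)‖ ≤ L * (s * ‖g‖) := by
      simpa [norm_smul, abs_of_pos hs] using hL x (x - s • g)
    have hinner := real_inner_le_norm (g - gradient f (x - s • g)) g
    rw [inner_sub_left, real_inner_self_eq_norm_sq] at hinner
    nlinarith [mul_le_mul_of_nonneg_right hlip (norm_nonneg g)]
  have h := hanti Set.self_mem_Ici (Set.mem_Ici.2 hη) hη
  simp only [zero_smul, sub_zero] at h
  linarith

theorem log_sub_le_sum_range_step {L : ℝ} (hL : 0 ≤ L) (T : ℕ) :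
    Real.log ((T : ℝ) + 2) - L + L / (2 * ((T : ℝ) + 1)) ≤
      ∑ t ∈ Finset.range (T + 1), (1 / ((t : ℝ) + 1) - L / 2 * (1 / ((t : ℝ) + 1)) ^ 2) := by
  induction T with
  | zero =>
    have h := Real.log_le_sub_one_of_pos (show (0 : ℝ) < 2 by norm_num)
    norm_num
    linarith
  | succ n ih =>
    rw [Finset.sum_range_succ]
    push_cast
    have hn : (0 : ℝ) ≤ n := n.cast_nonneg
    have hlog : Real.log ((n : ℝ) + 1 + 2) ≤ Real.log ((n : ℝ) + 2) + 1 / ((n : ℝ) + 1 + 1) := by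
      have h := Real.log_le_sub_one_of_pos (show 0 < ((n : ℝ) + 1 + 2) / ((n : ℝ) + 2) by positivity)
      rw [Real.log_div (by positivity) (by positivity)] at h
      have heq : ((n : ℝ) + 1 + 2) / ((n : ℝ) + 2) - 1 = 1 / ((n : ℝ) + 1 + 1) := by
        field_simp
        ring
      linarith
    have hsq : L / (2 * ((n : ℝ) + 1 + 1)) + L / 2 * (1 / ((n : ℝ) + 1 + 1)) ^ 2
        ≤ L / (2 * ((n : ℝ) + 1)) := by
      have heq : L / (2 * ((n : ℝ) + 1)) - (L / (2 * ((n : ℝ) + 1 + 1))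
          + L / 2 * (1 / ((n : ℝ) + 1 + 1)) ^ 2)
          = L / (2 * ((n : ℝ) + 1) * ((n : ℝ) + 1 + 1) ^ 2) := by
        field_simp
        ring
      have : 0 ≤ L / (2 * ((n : ℝ) + 1) * ((n : ℝ) + 1 + 1) ^ 2) := by positivity
      linarith
    linarith

/-- Early steps with `2 (t + 1) < L` may have a negative coefficient; they are discarded using
`a ≤ R`. -/
theorem mul_sum_range_step_le {a g : ℕ → ℝ} {R L B : ℝ} (hB : 0 ≤ B) (haR : ∀ t, a t ≤ R)
    (hstep : ∀ t : ℕ, a (t + 1) ≤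
      a t - (1 / ((t : ℝ) + 1) - L / 2 * (1 / ((t : ℝ) + 1)) ^ 2) * g t)
    (N : ℕ) (hg : ∀ t < N, B ≤ g t) :
    B * ∑ t ∈ Finset.range N, (1 / ((t : ℝ) + 1) - L / 2 * (1 / ((t : ℝ) + 1)) ^ 2)
      ≤ R - a N := by
  suffices H : ∀ n ≤ N,
      B * ∑ t ∈ Finset.range n, (1 / ((t : ℝ) + 1) - L / 2 * (1 / ((t : ℝ) + 1)) ^ 2)
        ≤ R - a n ∧
      (∑ t ∈ Finset.range n, (1 / ((t : ℝ) + 1) - L / 2 * (1 / ((t : ℝ) + 1)) ^ 2) ≤ 0 ∨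
        L ≤ 2 * n) from (H N le_rfl).1
  intro n
  induction n with
  | zero => simp [haR]
  | succ n ih =>
    intro hn
    obtain ⟨hle, hsign⟩ := ih (by omega)
    rw [Finset.sum_range_succ]
    set S := ∑ t ∈ Finset.range n, (1 / ((t : ℝ) + 1) - L / 2 * (1 / ((t : ℝ) + 1)) ^ 2)
    have hcoef : 1 / ((n : ℝ) + 1) - L / 2 * (1 / ((n : ℝ) + 1)) ^ 2
        = (2 * ((n : ℝ) + 1) - L) / (2 * ((n : ℝ) + 1) ^ 2) := by
      field_simp
    rcases le_or_gt L (2 * ((n : ℝ) + 1)) with h | h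
    · have hc : 0 ≤ 1 / ((n : ℝ) + 1) - L / 2 * (1 / ((n : ℝ) + 1)) ^ 2 := by
        rw [hcoef]
        exact div_nonneg (by linarith) (by positivity)
      refine ⟨?_, Or.inr (by push_cast; exact h)⟩
      have := mul_le_mul_of_nonneg_left (hg n (by omega)) hc
      linarith [hstep n]
    · have hc : 1 / ((n : ℝ) + 1) - L / 2 * (1 / ((n : ℝ) + 1)) ^ 2 ≤ 0 := by
        rw [hcoef]
        exact div_nonpos_of_nonpos_of_nonneg (by linarith) (by positivity)
      have hS : S ≤ 0 := hsign.resolve_right (by linarith)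
      have hS' := add_nonpos hS hc
      exact ⟨by linarith [mul_nonpos_of_nonneg_of_nonpos hB hS', haR (n + 1)], Or.inl hS'⟩

theorem eq_zero_of_lipschitz_neg {E : Type*} [NormedAddCommGroup E] {G : E → E} {C : ℝ}
    (hC : C < 0) (hG : ∀ x y, ‖G x - G y‖ ≤ C * ‖x - y‖) (v : E) : v = 0 := by
  have h := (norm_nonneg _).trans (hG v 0)
  rw [sub_zero] at h
  exact norm_le_zero_iff.1 (nonpos_of_mul_nonneg_right h hC)


/-- `O(1/log T)` convergence of alternating gradient descent with diminishing step sizes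
`η_t = 1/(t+1)`: if `0 ≤ F ≤ R` with blockwise Lipschitz gradients and
`L = max(L_W, L_K)`, then for every `T` with `ln(T+2) − L + L/(2(T+1)) > 0`,
`min_{0 ≤ t ≤ T} (‖∇_K F(W^t,K^t)‖² + ‖∇_W F(W^t,K^{t+1})‖²)
  ≤ 2R / (ln(T+2) − L + L/(2(T+1)))`. -/
theorem alternating_descent_diminishing_rate {m d : ℕ}
    (F : EuclideanSpace ℝ (Fin m × Fin d) → EuclideanSpace ℝ (Fin m × Fin m) → ℝ)
    (hF : Differentiable ℝ fun p : EuclideanSpace ℝ (Fin m × Fin d) ×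
      EuclideanSpace ℝ (Fin m × Fin m) => F p.1 p.2)
    (R : ℝ) (hFR : ∀ W K, 0 ≤ F W K ∧ F W K ≤ R)
    (LK LW : ℝ)
    (hLK : ∀ (W : EuclideanSpace ℝ (Fin m × Fin d))
        (K₁ K₂ : EuclideanSpace ℝ (Fin m × Fin m)),
        ‖gradient (fun K => F W K) K₁ - gradient (fun K => F W K) K₂‖ ≤ LK * ‖K₁ - K₂‖)
    (hLW : ∀ (K : EuclideanSpace ℝ (Fin m × Fin m))
        (W₁ W₂ : EuclideanSpace ℝ (Fin m × Fin d)),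
        ‖gradient (fun W => F W K) W₁ - gradient (fun W => F W K) W₂‖ ≤ LW * ‖W₁ - W₂‖)
    (L : ℝ) (hL : L = max LW LK)
    (W : ℕ → EuclideanSpace ℝ (Fin m × Fin d))
    (K : ℕ → EuclideanSpace ℝ (Fin m × Fin m))
    (hK : ∀ t : ℕ, K (t + 1)
      = K t - (1 / ((t : ℝ) + 1)) • gradient (fun K' => F (W t) K') (K t))
    (hW : ∀ t : ℕ, W (t + 1)
      = W t - (1 / ((t : ℝ) + 1)) • gradient (fun W' => F W' (K (t + 1))) (W t)) :
    ∀ T : ℕ, 0 < Real.log ((T : ℝ) + 2) - L + L / (2 * ((T : ℝ) + 1)) →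
      ∃ t ≤ T,
        ‖gradient (fun K' => F (W t) K') (K t)‖ ^ 2
          + ‖gradient (fun W' => F W' (K (t + 1))) (W t)‖ ^ 2
        ≤ 2 * R / (Real.log ((T : ℝ) + 2) - L + L / (2 * ((T : ℝ) + 1))) := by
  intro T hT
  have hR : 0 ≤ R := (hFR (W 0) (K 0)).1.trans (hFR (W 0) (K 0)).2
  rcases lt_or_ge L 0 with hneg | hpos
  · refine ⟨0, T.zero_le, ?_⟩
    have hLW0 : LW < 0 := (le_max_left LW LK).trans_lt (hL ▸ hneg)
    have hLK0 : LK < 0 := (le_max_right LW LK).trans_lt (hL ▸ hneg)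
    rw [eq_zero_of_lipschitz_neg hLK0 (hLK (W 0)) (gradient (fun K' => F (W 0) K') (K 0)),
      eq_zero_of_lipschitz_neg hLW0 (hLW (K (0 + 1)))
        (gradient (fun W' => F W' (K (0 + 1))) (W 0))]
    simp only [norm_zero, ne_eq, OfNat.ofNat_ne_zero, not_false_eq_true, zero_pow, add_zero]
    positivity
  set g : ℕ → ℝ := fun t => ‖gradient (fun K' => F (W t) K') (K t)‖ ^ 2
    + ‖gradient (fun W' => F W' (K (t + 1))) (W t)‖ ^ 2 with hg
  have hdK : ∀ W, Differentiable ℝ fun K => F W K := fun W =>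
    hF.comp ((differentiable_const W).prodMk differentiable_id)
  have hdW : ∀ K, Differentiable ℝ fun W => F W K := fun K =>
    hF.comp (differentiable_id.prodMk (differentiable_const K))
  have hstep : ∀ t : ℕ, F (W (t + 1)) (K (t + 1)) ≤
      F (W t) (K t) - (1 / ((t : ℝ) + 1) - L / 2 * (1 / ((t : ℝ) + 1)) ^ 2) * g t := by
    intro t
    have hη : (0 : ℝ) ≤ 1 / ((t : ℝ) + 1) := by positivity
    have h₁ := apply_gradient_step_le (hdK (W t)) hη (L := L) (fun x y => (hLK _ x y).trans
      (mul_le_mul_of_nonneg_right (hL ▸ le_max_right LW LK) (norm_nonneg _))) (K t)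
    have h₂ := apply_gradient_step_le (hdW (K (t + 1))) hη (L := L) (fun x y => (hLW _ x y).trans
      (mul_le_mul_of_nonneg_right (hL ▸ le_max_left LW LK) (norm_nonneg _))) (W t)
    rw [← hK t] at h₁
    rw [← hW t] at h₂
    simp only [hg]
    linarith
  obtain ⟨t, ht, hmin⟩ := Finset.exists_min_image (Finset.range (T + 1)) g ⟨0, by simp⟩
  refine ⟨t, by simpa [Nat.lt_succ_iff] using ht, ?_⟩
  change g t ≤ _
  have hgt : 0 ≤ g t := by positivity
  have hsum := mul_sum_range_step_le (a := fun t => F (W t) (K t)) hgt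
    (fun t => (hFR _ _).2) hstep (T + 1) fun s hs => hmin s (Finset.mem_range.2 hs)
  rw [le_div_iff₀ hT]
  linarith [mul_le_mul_of_nonneg_left (log_sub_le_sum_range_step hpos T) hgt,
    (hFR (W (T + 1)) (K (T + 1))).1]
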